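/- Let N ≥ 3, let B be the open unit ball in ℝ^N, and let λ ∈ ℝ be arbitrary. Then there is no radial function u, continuously differentiable on the closed unit ball and twice continuously differentiable on B, with u > 0 in B and u = 0 on the unit sphere, satisfying −Δu(x) = (1 + λ)·u(x)^((N+2)/(N−2)) for all x ∈ B. -/

import Mathlib

open scoped NNReal
open MeasureTheory Filter Set Metric

noncomputable def laplacian {N : ℕ} (u : EuclideanSpace ℝ (Fin N) → ℝ)
    (x : EuclideanSpace ℝ (Fin N)) : ℝ :=
  ∑ i, fderiv ℝ (fun y => fderiv ℝ u y (EuclideanSpace.single i (1:ℝ))) x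
      (EuclideanSpace.single i (1:ℝ))

lemma hasFDerivAt_norm_aux {N : ℕ} (x : EuclideanSpace ℝ (Fin N)) (hx : x ≠ 0) :
    HasFDerivAt (fun y : EuclideanSpace ℝ (Fin N) => ‖y‖) (‖x‖⁻¹ • innerSL ℝ x) x := by
  have hn : ‖x‖ ≠ 0 := norm_ne_zero_iff.mpr hx
  have h1 := (hasStrictFDerivAt_norm_sq x).hasFDerivAt.sqrt (by positivity)
  have h2 : (fun y : EuclideanSpace ℝ (Fin N) => Real.sqrt (‖y‖ ^ 2)) = fun y => ‖y‖ := by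
    funext y; exact Real.sqrt_sq (norm_nonneg y)
  rw [h2, Real.sqrt_sq (norm_nonneg x)] at h1
  have h3 : (1 / (2 * ‖x‖)) • (2 : ℕ) • innerSL ℝ x = ‖x‖⁻¹ • innerSL ℝ x := by
    ext y
    simp
    field_simp
  rw [← h3]
  exact h1

lemma radial_laplacian {N : ℕ} (u : EuclideanSpace ℝ (Fin N) → ℝ) (v d : ℝ → ℝ) (D : ℝ)
    (x : EuclideanSpace ℝ (Fin N)) (hx : x ≠ 0) (hx1 : ‖x‖ < 1)
    (huv : ∀ y, u y = v ‖y‖)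
    (hv : ∀ t ∈ Ioo (0:ℝ) 1, HasDerivAt v (d t) t)
    (hd : HasDerivAt d D ‖x‖) :
    laplacian u x = D + ((N:ℝ) - 1) / ‖x‖ * d ‖x‖ := by
  have hn : ‖x‖ ≠ 0 := norm_ne_zero_iff.mpr hx
  have hev : ∀ᶠ y in nhds x, y ≠ 0 ∧ ‖y‖ < 1 :=
    Filter.Eventually.and (isOpen_ne.mem_nhds hx)
      ((isOpen_lt continuous_norm continuous_const).mem_nhds hx1)
  have hfst : ∀ y : EuclideanSpace ℝ (Fin N), y ≠ 0 ∧ ‖y‖ < 1 → ∀ i,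
      fderiv ℝ u y (EuclideanSpace.single i (1:ℝ)) = d ‖y‖ * (‖y‖⁻¹ * y i) := by
    intro y hy i
    have hu : u = v ∘ (fun y => ‖y‖) := by funext z; exact huv z
    have h := (hv ‖y‖ ⟨norm_pos_iff.mpr hy.1, hy.2⟩).comp_hasFDerivAt y
      (hasFDerivAt_norm_aux y hy.1)
    rw [hu, h.fderiv]
    simp [EuclideanSpace.inner_single_right]
  have hsnd : ∀ i, fderiv ℝ (fun y => fderiv ℝ u y (EuclideanSpace.single i (1:ℝ))) x
      (EuclideanSpace.single i (1:ℝ)) =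
      D * (x i)^2 / ‖x‖^2 + d ‖x‖ * (1 / ‖x‖ - (x i)^2 / ‖x‖^3) := by
    intro i
    have he : (fun y => fderiv ℝ u y (EuclideanSpace.single i (1:ℝ))) =ᶠ[nhds x]
        fun y => d ‖y‖ * (‖y‖⁻¹ * y i) := by
      filter_upwards [hev] with y hy using hfst y hy i
    have hnx := hasFDerivAt_norm_aux x hx
    have h1 := hd.comp_hasFDerivAt x hnx
    have h2 := (hasDerivAt_inv hn).comp_hasFDerivAt x hnx
    have h3 : HasFDerivAt (fun y : EuclideanSpace ℝ (Fin N) => y i)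
      (EuclideanSpace.proj i : EuclideanSpace ℝ (Fin N) →L[ℝ] ℝ) x :=
      (EuclideanSpace.proj i : EuclideanSpace ℝ (Fin N) →L[ℝ] ℝ).hasFDerivAt
    have h4 := h1.mul (h2.mul h3)
    have h5 : HasFDerivAt (fun y : EuclideanSpace ℝ (Fin N) => d ‖y‖ * (‖y‖⁻¹ * y i)) _ x := h4
    rw [he.fderiv_eq, h5.fderiv]
    simp [EuclideanSpace.inner_single_right]
    field_simp
    ring
  unfold laplacian
  rw [Finset.sum_congr rfl (fun i _ => hsnd i)]
  have hs : ∑ i, (x i)^2 = ‖x‖^2 := by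
    rw [EuclideanSpace.norm_sq_eq]; simp
  have h1 : ∑ i, D * (x i)^2 / ‖x‖^2 = D * ‖x‖^2 / ‖x‖^2 := by
    rw [← Finset.sum_div, ← Finset.mul_sum, hs]
  have h2 : ∑ i, (x i)^2 / ‖x‖^3 = ‖x‖^2 / ‖x‖^3 := by
    rw [← Finset.sum_div, hs]
  rw [Finset.sum_add_distrib, ← Finset.mul_sum, Finset.sum_sub_distrib, h1, h2]
  simp
  field_simp

/-- Pohozaev argument for the ODE. -/
lemma ode_no_sol (N : ℕ) (hN : 3 ≤ N) (c : ℝ) (v g D : ℝ → ℝ)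
    (hv : ContinuousOn v (Icc 0 1)) (hg : ContinuousOn g (Icc 0 1))
    (hvd : ∀ t ∈ Ioo (0:ℝ) 1, HasDerivAt v (g t) t)
    (hgd : ∀ t ∈ Ioo (0:ℝ) 1, HasDerivAt g (D t) t)
    (hode : ∀ t ∈ Ioo (0:ℝ) 1,
      -(D t + ((N:ℝ) - 1) / t * g t) = c * v t ^ (((N : ℝ) + 2) / ((N : ℝ) - 2)))
    (hpos : ∀ t ∈ Ico (0:ℝ) 1, 0 < v t) (hv1 : v 1 = 0) : False := by
  have hN' : (3:ℝ) ≤ N := by exact_mod_cast hN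
  have hN2 : (N:ℝ) - 2 ≠ 0 := by linarith
  obtain ⟨M, rfl⟩ : ∃ M, N = M + 1 := ⟨N - 1, by omega⟩
  push_cast at *
  set p : ℝ := ((M:ℝ) + 1 + 2) / ((M:ℝ) + 1 - 2) with hp
  have hp1 : p + 1 = 2 * ((M:ℝ)+1) / ((M:ℝ) + 1 - 2) := by rw [hp]; field_simp; ring
  have hp1pos : 0 < p + 1 := by rw [hp1]; apply div_pos <;> linarith
  have hM : M ≠ 0 := by omega
  have const_of : ∀ f : ℝ → ℝ, ContinuousOn f (Icc 0 1) →
      (∀ t ∈ Ioo (0:ℝ) 1, HasDerivAt f 0 t) → ∀ t ∈ Icc (0:ℝ) 1, f t = f 0 := by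
    intro f hf hf' t ht
    rcases eq_or_lt_of_le ht.1 with h0 | h0
    · rw [← h0]
    obtain ⟨s, hs, h⟩ := exists_hasDerivAt_eq_slope f (fun _ => 0) h0
      (hf.mono (Icc_subset_Icc le_rfl ht.2)) (fun s hs => hf' s ⟨hs.1, hs.2.trans_le ht.2⟩)
    have : t - 0 ≠ 0 := by linarith
    field_simp at h
    linarith
  have hDeq : ∀ t ∈ Ioo (0:ℝ) 1, t * D t = - (M * g t) - t * (c * v t ^ p) := by
    intro t ht
    have h := hode t ht
    have ht0 : t ≠ 0 := ht.1.ne'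
    rw [← h]; field_simp; ring
  have hW : ∀ t ∈ Ioo (0:ℝ) 1, HasDerivAt (fun t => t ^ M * g t) (-(t ^ M * (c * v t ^ p))) t := by
    intro t ht
    refine ((hasDerivAt_pow M t).mul (hgd t ht)).congr_deriv ?_
    obtain ⟨K, rfl⟩ := Nat.exists_eq_succ_of_ne_zero hM
    have := hDeq t ht
    simp only [Nat.succ_eq_add_one, Nat.add_sub_cancel, pow_succ] at this ⊢
    linear_combination (t^K) * this
  have hWc : ContinuousOn (fun t => t ^ M * g t) (Icc 0 1) := by fun_prop
  -- Pohozaev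
  have hPc : ContinuousOn (fun t => t * (t^M * g t) * g t / 2 +
      c * t^(M+1) * v t ^ (p+1) / (p+1) + ((M:ℝ) + 1 - 2)/2 * ((t^M * g t) * v t)) (Icc 0 1) := by
    have : ContinuousOn (fun t => v t ^ (p+1)) (Icc 0 1) :=
      hv.rpow_const (fun _ _ => Or.inr hp1pos.le)
    fun_prop
  have hP : ∀ t ∈ Ioo (0:ℝ) 1, HasDerivAt (fun t => t * (t^M * g t) * g t / 2 +
      c * t^(M+1) * v t ^ (p+1) / (p+1) + ((M:ℝ) + 1 - 2)/2 * ((t^M * g t) * v t)) 0 t := by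
    intro t ht
    have hvp := hpos t ⟨ht.1.le, ht.2⟩
    have hr := (hvd t ht).rpow_const (p := p+1) (Or.inl hvp.ne')
    have h1 := ((((hasDerivAt_id t).mul (hW t ht)).mul (hgd t ht)).div_const 2)
    have h2 := ((((hasDerivAt_pow (M+1) t).const_mul c).mul hr).div_const (p+1))
    have h3 := ((hW t ht).mul (hvd t ht)).const_mul (((M:ℝ) + 1 - 2)/2)
    refine ((h1.add h2).add h3).congr_deriv ?_
    have hv' : v t ^ (p+1) = v t ^ p * v t := by rw [Real.rpow_add_one hvp.ne']
    have e := hDeq t ht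
    have hpi : ((M:ℝ)+1) / (p+1) = ((M:ℝ)+1-2)/2 := by
      rw [hp1]; field_simp
    simp only [id, add_sub_cancel_right, hv']
    push_cast
    have : c * (((M:ℝ) + 1) * t ^ M) * (v t ^ p * v t) / (p+1)
      = c * t^M * (v t ^ p * v t) * (((M:ℝ)+1-2)/2) := by rw [← hpi]; ring
    have this2 : c * t ^ (M + 1) * (g t * (p + 1) * v t ^ p) / (p + 1)
      = c * t ^ (M + 1) * (g t * v t ^ p) := by field_simp
    rw [add_div (c * (((M:ℝ) + 1) * t ^ M) * (v t ^ p * v t)), this, this2]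
    simp only [Pi.mul_apply, id]
    linear_combination (t^M * g t / 2) * e
  have hP1 := const_of _ hPc hP 1 (by simp)
  simp [hv1, hp1pos.ne', Real.zero_rpow, hM] at hP1
  -- c = 0
  have hc : c = 0 := by
    obtain ⟨s, hs, h⟩ := exists_hasDerivAt_eq_zero (f := fun t => t ^ M * g t)
      (f' := fun t => -(t ^ M * (c * v t ^ p))) zero_lt_one hWc (by simp [hM, hP1]) hW
    have h1 := hpos s ⟨hs.1.le, hs.2⟩
    have h2 := Real.rpow_pos_of_pos h1 p
    have h3 := pow_pos hs.1 M
    simpa [h2.ne', h3.ne', hs.1.ne'] using h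
  have hW0 := const_of _ hWc (fun t ht => by simpa [hc] using hW t ht)
  have hv0 := const_of v hv (fun t ht => by
    have := hW0 t ⟨ht.1.le, ht.2.le⟩
    have h3 := pow_pos ht.1 M
    have h4 : g t = 0 := by simpa [hM, h3.ne', ht.1.ne'] using this
    simpa [h4] using hvd t ht) 1 (by simp)
  have := hpos 0 (by simp)
  linarith

theorem stmt_8 (N : ℕ) (hN : 3 ≤ N) (lam : ℝ) :
    ¬ ∃ u : EuclideanSpace ℝ (Fin N) → ℝ,
      (∀ x y : EuclideanSpace ℝ (Fin N), ‖x‖ = ‖y‖ → u x = u y) ∧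
      ContDiffOn ℝ 1 u (closedBall 0 1) ∧
      ContDiffOn ℝ 2 u (ball 0 1) ∧
      (∀ x ∈ ball (0 : EuclideanSpace ℝ (Fin N)) 1, 0 < u x) ∧
      (∀ x ∈ sphere (0 : EuclideanSpace ℝ (Fin N)) 1, u x = 0) ∧
      (∀ x ∈ ball (0 : EuclideanSpace ℝ (Fin N)) 1,
        -laplacian u x = (1 + lam) * u x ^ (((N : ℝ) + 2) / ((N : ℝ) - 2))) := by
  rintro ⟨u, hrad, hC1, hC2, hpos, hbd, heq⟩
  set e : EuclideanSpace ℝ (Fin N) := EuclideanSpace.single ⟨0, by omega⟩ (1:ℝ) with he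
  have hen : ‖e‖ = 1 := by simp [he]
  have hte : ∀ t : ℝ, ‖t • e‖ = |t| := by intro t; simp [norm_smul, hen]
  set v : ℝ → ℝ := fun t => u (t • e) with hvdef
  have hlin : ContDiff ℝ 2 (fun t : ℝ => t • e) := by fun_prop
  have hv1 : ContDiffOn ℝ 1 v (Icc (-1) 1) := by
    refine hC1.comp (hlin.of_le (by norm_num)).contDiffOn ?_
    intro t ht
    simpa [hte, abs_le] using ht
  have hv2 : ContDiffOn ℝ 2 v (Ioo (-1) 1) := by
    refine hC2.comp hlin.contDiffOn ?_
    intro t ht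
    simpa [hte, abs_lt] using ht
  set g : ℝ → ℝ := derivWithin v (Icc (-1) 1) with hgdef
  have hgc : ContinuousOn g (Icc (-1) 1) :=
    hv1.continuousOn_derivWithin (uniqueDiffOn_Icc (by norm_num)) le_rfl
  have hgv : ∀ t ∈ Ioo (-1:ℝ) 1, g t = deriv v t := by
    intro t ht
    exact derivWithin_of_mem_nhds (Icc_mem_nhds ht.1 ht.2)
  have hsub : ∀ t ∈ Ioo (0:ℝ) 1, t ∈ Ioo (-1:ℝ) 1 := fun t ht => ⟨by linarith [ht.1], ht.2⟩
  have hvd : ∀ t ∈ Ioo (0:ℝ) 1, HasDerivAt v (g t) t := by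
    intro t ht
    rw [hgv t (hsub t ht)]
    have := (hv2.contDiffAt (isOpen_Ioo.mem_nhds (hsub t ht))).differentiableAt (by norm_num)
    exact this.hasDerivAt
  have hd1 : ContDiffOn ℝ 1 (deriv v) (Ioo (-1) 1) :=
    ((contDiffOn_succ_iff_deriv_of_isOpen (n := 1) isOpen_Ioo).1 (by simpa [one_add_one_eq_two] using hv2)).2.2
  have hgd : ∀ t ∈ Ioo (0:ℝ) 1, HasDerivAt g (deriv (deriv v) t) t := by
    intro t ht
    have h := (hd1.contDiffAt (isOpen_Ioo.mem_nhds (hsub t ht))).differentiableAt (by norm_num)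
    refine h.hasDerivAt.congr_of_eventuallyEq ?_
    filter_upwards [isOpen_Ioo.mem_nhds (hsub t ht)] with s hs using hgv s hs
  have hIcc : Icc (0:ℝ) 1 ⊆ Icc (-1) 1 := Icc_subset_Icc (by norm_num) le_rfl
  refine ode_no_sol N hN (1 + lam) v g (deriv (deriv v)) (hv1.continuousOn.mono hIcc)
    (hgc.mono hIcc) hvd hgd ?_ ?_ ?_
  · intro t ht
    have hnt : ‖t • e‖ = t := by rw [hte, abs_of_pos ht.1]
    have hL := radial_laplacian u v g (deriv (deriv v) t) (t • e)
      (by rw [← norm_ne_zero_iff, hnt]; exact ht.1.ne') (by rw [hnt]; exact ht.2)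
      (fun y => hrad _ _ (by rw [hte, abs_norm])) hvd (by rw [hnt]; exact hgd t ht)
    rw [hnt] at hL
    rw [← hL]
    exact heq (t • e) (by rw [mem_ball_zero_iff, hnt]; exact ht.2)
  · intro t ht
    exact hpos _ (by rw [mem_ball_zero_iff, hte, abs_of_nonneg ht.1]; exact ht.2)
  · exact hbd _ (by simp [hen])
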